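/- Let r ≥ 1, let K be an odd positive integer, and let m₁, …, m_r : S² → ℝ be continuous functions whose span contains the constant function 1 and such that every nontrivial linear combination b·m (with b ≠ 0) vanishes only on a set of surface measure zero. Then the moment-inversion problem is uniquely solvable: the moment map M : ℝ^r → ℝ^r defined by M(λ)ᵢ = ∫_{S²} mᵢ(Ω)·(1 + (λ·m(Ω))/K)^K dΩ is a bijection of ℝ^r onto ℝ^r; i.e., for every ρ* ∈ ℝ^r there exists a unique λ* ∈ ℝ^r with M(λ*) = ρ*. -/

import Mathlib

open MeasureTheory Metric Matrix

/-- The unit sphere `S²` in euclidean space `ℝ³`. -/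
abbrev S2 : Set (EuclideanSpace ℝ (Fin 3)) := Metric.sphere (0 : EuclideanSpace ℝ (Fin 3)) 1

/-- The surface measure on the unit sphere `S² ⊂ ℝ³` (total mass `4π`). -/
noncomputable def sphereMeasure : Measure S2 :=
  (volume : Measure (EuclideanSpace ℝ (Fin 3))).toSphere

/-- The moment map of the `β_K` closure:
`M(λ)ᵢ = ∫_{S²} mᵢ(Ω)·(1 + (λ·m(Ω))/K)^K dΩ`. -/
noncomputable def momentMap (r K : ℕ) (m : Fin r → S2 → ℝ) (lam : Fin r → ℝ) :
    Fin r → ℝ :=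
  fun i => ∫ Ω, m i Ω * (1 + (∑ j, lam j * m j Ω) / (K : ℝ)) ^ K ∂sphereMeasure


instance sphereMeasure_finite : IsFiniteMeasure sphereMeasure := by
  unfold sphereMeasure; infer_instance

lemma sphereMeasure_ne : sphereMeasure ≠ 0 := by
  unfold sphereMeasure
  exact Measure.toSphere_ne_zero _

lemma cont_int {f : S2 → ℝ} (hf : Continuous f) : Integrable f sphereMeasure :=
  hf.integrable_of_hasCompactSupport (HasCompactSupport.of_compactSpace f)

lemma aux_zero (r : ℕ) (m : Fin r → S2 → ℝ)
    (hindep : ∀ b : Fin r → ℝ, b ≠ 0 →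
      sphereMeasure {Ω : S2 | ∑ i, b i * m i Ω = 0} = 0)
    (b : Fin r → ℝ) (f : S2 → ℝ) (hf : Continuous f) (h0 : ∀ x, 0 ≤ f x)
    (hi : ∫ x, f x ∂sphereMeasure = 0) (hb : ∀ x, f x = 0 → ∑ i, b i * m i x = 0) : b = 0 := by
  by_contra hne
  have h1 := hindep b hne
  rw [integral_eq_zero_iff_of_nonneg h0 (cont_int hf)] at hi
  have h2 : ∀ᵐ x ∂sphereMeasure, ¬ (∑ i, b i * m i x = 0) := by
    rw [ae_iff]; simpa using h1
  have h3 : ∀ᵐ x ∂sphereMeasure, False := by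
    filter_upwards [hi, h2] with x hx hx2
    exact hx2 (hb x hx)
  rw [Filter.eventually_false_iff_eq_bot, ae_eq_bot] at h3
  exact sphereMeasure_ne h3

lemma tangent (K : ℕ) (hK : Odd K) (a b : ℝ) :
    b ^ (K+1) - a ^ (K+1) ≤ (K+1) * (b ^ K * (b - a)) := by
  have hc : ConvexOn ℝ Set.univ (fun x : ℝ => x ^ (K+1)) := (hK.add_one).convexOn_pow
  have hd : HasDerivAt (fun x : ℝ => x ^ (K+1)) ((K+1) * b ^ K) b := by
    simpa using hasDerivAt_pow (K+1) b
  rcases lt_trichotomy a b with h | h | h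
  · have := hc.slope_le_of_hasDerivAt (Set.mem_univ a) (Set.mem_univ b) h hd
    rw [slope_def_field, div_le_iff₀ (by linarith)] at this
    linarith
  · subst h; simp
  · have := hc.le_slope_of_hasDerivAt (Set.mem_univ b) (Set.mem_univ a) h hd
    rw [slope_def_field, le_div_iff₀ (by linarith)] at this
    linarith

noncomputable def GG (r K : ℕ) (m : Fin r → S2 → ℝ) (u : Fin r → ℝ) : Fin r → ℝ :=
  fun i => ∫ Ω, m i Ω * (∑ j, u j * m j Ω) ^ K ∂sphereMeasure

section
variable {r K : ℕ} {m : Fin r → S2 → ℝ}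

lemma GG_cont (hm : ∀ i, Continuous (m i)) : Continuous (GG r K m) := by
  refine continuous_pi fun i => ?_
  have h : Continuous (Function.uncurry
      (fun (u : Fin r → ℝ) (Ω : S2) => m i Ω * (∑ j, u j * m j Ω) ^ K)) := by
    unfold Function.uncurry
    fun_prop
  have h2 := continuous_parametric_integral_of_continuous (μ := sphereMeasure) h
    (s := Set.univ) isCompact_univ
  simpa [GG] using h2

lemma GG_dot (hm : ∀ i, Continuous (m i)) (v u : Fin r → ℝ) :
    ∑ i, v i * GG r K m u i =
      ∫ Ω, (∑ j, v j * m j Ω) * (∑ j, u j * m j Ω) ^ K ∂sphereMeasure := by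
  simp only [GG, Finset.sum_mul]
  rw [integral_finsetSum]
  · refine Finset.sum_congr rfl fun i _ => ?_
    rw [← integral_const_mul]
    simp only [mul_assoc]
  · intro i _
    exact cont_int (by fun_prop)

lemma GG_inj (hK : Odd K) (hm : ∀ i, Continuous (m i))
    (hindep : ∀ b : Fin r → ℝ, b ≠ 0 →
      sphereMeasure {Ω : S2 | ∑ i, b i * m i Ω = 0} = 0) :
    Function.Injective (GG r K m) := by
  intro a b hab
  rw [← sub_eq_zero]
  have hs := hK.strictMono_pow (R := ℝ)
  have key : ∀ Ω, ∑ j, (a - b) j * m j Ω = ∑ j, a j * m j Ω - ∑ j, b j * m j Ω := by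
    intro Ω; simp [sub_mul]
  refine aux_zero r m hindep (a - b) (fun Ω => (∑ j, (a - b) j * m j Ω) *
    ((∑ j, a j * m j Ω) ^ K - (∑ j, b j * m j Ω) ^ K)) (by fun_prop) ?_ ?_ ?_
  · intro Ω
    simp only [key]
    rcases le_total (∑ j, a j * m j Ω) (∑ j, b j * m j Ω) with h | h
    · exact mul_nonneg_of_nonpos_of_nonpos (by linarith) (sub_nonpos.2 (hs.monotone h))
    · exact mul_nonneg (by linarith) (sub_nonneg.2 (hs.monotone h))
  · simp only [mul_sub]
    rw [integral_sub (cont_int (by fun_prop)) (cont_int (by fun_prop)), ← GG_dot hm, ← GG_dot hm,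
      hab, sub_self]
  · intro Ω h
    rcases mul_eq_zero.1 h with h | h
    · exact h
    · rw [key, hs.injective (sub_eq_zero.1 h), sub_self]

lemma GG_surj (hK : Odd K) (hm : ∀ i, Continuous (m i))
    (hindep : ∀ b : Fin r → ℝ, b ≠ 0 →
      sphereMeasure {Ω : S2 | ∑ i, b i * m i Ω = 0} = 0) :
    Function.Surjective (GG r K m) := by
  intro ρ
  have hG : Continuous (GG r K m) := GG_cont hm
  have hGi : ∀ i, Continuous (fun u => GG r K m u i) := fun i => (continuous_apply i).comp hG
  set Φ : (Fin r → ℝ) → ℝ := fun u => ∑ i, u i * GG r K m u i with hΦ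
  have hΦc : Continuous Φ := by fun_prop
  have hΦe : ∀ u, Φ u = ∫ Ω, (∑ j, u j * m j Ω) ^ (K+1) ∂sphereMeasure := by
    intro u; simp only [hΦ, GG_dot hm, pow_succ']
  have hev : Even (K+1) := hK.add_one
  have hΦ0 : ∀ u, 0 ≤ Φ u := fun u => by
    rw [hΦe]; exact integral_nonneg fun Ω => hev.pow_nonneg _
  have hΦpos : ∀ u, u ≠ 0 → 0 < Φ u := fun u hu => by
    refine lt_of_le_of_ne (hΦ0 u) fun h => hu ?_
    refine aux_zero r m hindep u (fun Ω => (∑ j, u j * m j Ω) ^ (K+1)) (by fun_prop)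
      (fun Ω => hev.pow_nonneg _) ?_ ?_
    · rw [← hΦe, ← h]
    · intro Ω h; exact pow_eq_zero_iff (by omega) |>.1 h
  have hΦs : ∀ (t : ℝ) u, Φ (t • u) = t ^ (K+1) * Φ u := by
    intro t u
    rw [hΦe, hΦe, ← integral_const_mul]
    congr 1; ext Ω
    rw [← mul_pow, Finset.mul_sum]
    simp [mul_assoc]
  obtain ⟨δ, hδ, hδΦ⟩ : ∃ δ > 0, ∀ u, δ * ‖u‖ ^ (K+1) ≤ Φ u := by
    have hpos : ∃ δ > 0, ∀ u ∈ sphere (0 : Fin r → ℝ) 1, δ ≤ Φ u := by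
      rcases (sphere (0 : Fin r → ℝ) 1).eq_empty_or_nonempty with h | h
      · exact ⟨1, one_pos, by simp [h]⟩
      · obtain ⟨u, hu, hmin⟩ := (isCompact_sphere (0 : Fin r → ℝ) 1).exists_isMinOn h hΦc.continuousOn
        refine ⟨Φ u, hΦpos u ?_, fun v hv => hmin hv⟩
        rintro rfl; simp at hu
    obtain ⟨δ, hδ, h⟩ := hpos
    refine ⟨δ, hδ, fun u => ?_⟩
    by_cases hu : u = 0
    · subst hu; simpa using hΦ0 0
    have hn : ‖u‖ ≠ 0 := norm_ne_zero_iff.2 hu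
    have h1 := h (‖u‖⁻¹ • u) (by simp [norm_smul, hn])
    have h2 : Φ u = ‖u‖ ^ (K+1) * Φ (‖u‖⁻¹ • u) := by
      rw [← hΦs, smul_smul, mul_inv_cancel₀ hn, one_smul]
    rw [h2, mul_comm]
    gcongr
  set J : (Fin r → ℝ) → ℝ := fun u => Φ u - (K+1) * ∑ i, ρ i * u i with hJ
  have hJc : Continuous J := by fun_prop
  set R : ℝ := ∑ i, |ρ i| with hR
  have hlin : ∀ u : Fin r → ℝ, ∑ i, ρ i * u i ≤ R * ‖u‖ := by
    intro u
    rw [hR, Finset.sum_mul]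
    refine Finset.sum_le_sum fun i _ => ?_
    calc ρ i * u i ≤ |ρ i * u i| := le_abs_self _
      _ = |ρ i| * |u i| := abs_mul _ _
      _ ≤ |ρ i| * ‖u‖ := by gcongr; exact norm_le_pi_norm u i
  have hJ0 : J 0 = 0 := by simp [hJ, hΦ]
  obtain ⟨u, hu⟩ : ∃ u, ∀ v, J u ≤ J v := by
    refine hJc.exists_forall_le' 0 ?_
    have h1 := (tendsto_norm_cocompact_atTop (E := Fin r → ℝ)).eventually_ge_atTop
      (max 1 ((K+1) * R / δ))
    filter_upwards [h1] with v hv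
    have h2 : 1 ≤ ‖v‖ := le_trans (le_max_left _ _) hv
    have h3 : (K+1) * R / δ ≤ ‖v‖ := le_trans (le_max_right _ _) hv
    rw [div_le_iff₀ hδ] at h3
    have h4 : ‖v‖ ^ 2 ≤ ‖v‖ ^ (K+1) := pow_le_pow_right₀ h2 (by have := hK.pos; omega)
    have h5 := hδΦ v
    have h6 := hlin v
    rw [hJ0]
    have h7 : δ * ‖v‖ ^ 2 ≤ Φ v := le_trans (by gcongr) h5
    have h8 : ((K:ℝ)+1) * ∑ i, ρ i * v i ≤ (K+1) * (R * ‖v‖) := by gcongr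
    have h9 : (K+1) * R * ‖v‖ ≤ ‖v‖ * δ * ‖v‖ := by gcongr
    simp only [hJ]
    nlinarith
  refine ⟨u, funext fun i => ?_⟩
  -- variational inequality
  have hvar : ∀ t : ℝ, 0 ≤ t * (GG r K m (u + t • Pi.single i 1) i - ρ i) := by
    intro t
    set v : Fin r → ℝ := u + t • Pi.single i 1 with hv
    have h1 := hu v
    have h2 : Φ v - Φ u ≤ (K+1) * ∑ j, (v - u) j * GG r K m v j := by
      rw [hΦe, hΦe, GG_dot hm, ← integral_sub (cont_int (by fun_prop)) (cont_int (by fun_prop)),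
        ← integral_const_mul]
      refine integral_mono (cont_int (by fun_prop)) (cont_int (by fun_prop)) fun Ω => ?_
      refine (tangent K hK _ _).trans_eq ?_
      simp only [Pi.sub_apply, sub_mul, Finset.sum_sub_distrib]
      ring
    have h3 : ∑ j, (v - u) j * GG r K m v j = t * GG r K m v i := by
      simp [hv, Pi.single_apply]
    have h4 : ∑ j, ρ j * v j = ∑ j, ρ j * u j + t * ρ i := by
      simp [hv, mul_add, Finset.sum_add_distrib, Pi.single_apply, mul_comm]
    rw [h3] at h2
    simp only [hJ, h4] at h1
    have h5 : 0 ≤ ((K:ℝ)+1) * (t * (GG r K m v i - ρ i)) := by linarith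
    exact nonneg_of_mul_nonneg_right h5 (by positivity)
  set g : ℝ → ℝ := fun t => GG r K m (u + t • Pi.single i 1) i with hg
  have hgc : Continuous g := (hGi i).comp (by fun_prop)
  have hg0 : g 0 = GG r K m u i := by simp [hg]
  rw [← hg0]
  apply le_antisymm
  · refine le_of_tendsto (hgc.continuousWithinAt (s := Set.Iio 0) (x := 0)) ?_
    filter_upwards [self_mem_nhdsWithin] with t ht
    have := hvar t
    have ht : t < 0 := ht
    by_contra hc
    have : t * (g t - ρ i) < 0 := mul_neg_of_neg_of_pos ht (by linarith)
    linarith [hvar t]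
  · refine ge_of_tendsto (hgc.continuousWithinAt (s := Set.Ioi 0) (x := 0)) ?_
    filter_upwards [self_mem_nhdsWithin] with t ht
    have ht : 0 < t := ht
    by_contra hc
    have : t * (g t - ρ i) < 0 := mul_neg_of_pos_of_neg ht (by linarith)
    linarith [hvar t]

end

/-- unique solvability of the moment-inversion problem: if the span of
the continuous functions `m₁,…,m_r` contains the constant function `1` and every
nontrivial linear combination vanishes only on a set of surface measure zero, then the
moment map `M : ℝ^r → ℝ^r` of the `β_K` closure is a bijection, i.e. for every
`ρ* ∈ ℝ^r` there is a unique `λ*` with `M(λ*) = ρ*`. -/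
theorem momentMap_bijective (r : ℕ) (hr : 1 ≤ r)
    (K : ℕ) (hK : Odd K) (hKpos : 0 < K)
    (m : Fin r → S2 → ℝ) (hm : ∀ i, Continuous (m i))
    (hone : ∃ c : Fin r → ℝ, ∀ Ω : S2, ∑ i, c i * m i Ω = 1)
    (hindep : ∀ b : Fin r → ℝ, b ≠ 0 →
      sphereMeasure {Ω : S2 | ∑ i, b i * m i Ω = 0} = 0) :
    Function.Bijective (momentMap r K m) := by
  obtain ⟨c, hc⟩ := hone
  have hK0 : (K : ℝ) ≠ 0 := by positivity
  have hM : ∀ l, momentMap r K m l = GG r K m (c + (K:ℝ)⁻¹ • l) := by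
    intro l
    funext i
    simp only [momentMap, GG]
    congr 1; ext Ω
    congr 2
    rw [← hc Ω, Finset.sum_div, ← Finset.sum_add_distrib]
    refine Finset.sum_congr rfl fun j _ => ?_
    simp only [Pi.add_apply, Pi.smul_apply, smul_eq_mul]
    field_simp
  constructor
  · intro a b hab
    rw [hM, hM] at hab
    have h := add_left_cancel (GG_inj hK hm hindep hab)
    exact smul_right_injective _ (inv_ne_zero hK0) h
  · intro ρ
    obtain ⟨u, hu⟩ := GG_surj hK hm hindep ρ
    refine ⟨(K:ℝ) • (u - c), ?_⟩
    rw [hM, smul_smul, inv_mul_cancel₀ hK0, one_smul, add_sub_cancel, hu]
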